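/- arXiv:2211.05519 — 3 statements merged into one kernel-verified Lean document; each statement's English description precedes it below -/
import Mathlib

section
/- For any ring A and its asymmetric cover Ã = [[A,0],[S̄,Ā]], the small finitistic dimension of the opposite ring vanishes: fin.dim Ã^op = 0. -/
set_option linter.unusedSectionVars false
set_option synthInstance.maxHeartbeats 1000000
set_option maxHeartbeats 1600000
set_option linter.unusedVariables false
set_option linter.unnecessarySeqFocus false

universe u
open MulOpposite Function DirectSum

/-! ### Lower triangular matrix rings -/

/-- The lower triangular matrix ring `[[A,0],[M,B]]` for a `B`-`A`-bimodule `M`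
(a left `B`-module with a commuting right `A`-action, the latter written as a
left `Aᵐᵒᵖ`-action). The element `⟨a, m, b⟩` represents the matrix `[[a,0],[m,b]]`. -/
@[ext] structure Tri (A B M : Type u) : Type u where
  a : A
  m : M
  b : B

namespace Tri
variable {A B M : Type u} [Ring A] [Ring B] [AddCommGroup M]
  [Module B M] [Module Aᵐᵒᵖ M] [SMulCommClass B Aᵐᵒᵖ M]

instance : Zero (Tri A B M) := ⟨⟨0, 0, 0⟩⟩
instance : Add (Tri A B M) := ⟨fun x y => ⟨x.a + y.a, x.m + y.m, x.b + y.b⟩⟩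
instance : Neg (Tri A B M) := ⟨fun x => ⟨-x.a, -x.m, -x.b⟩⟩
instance : One (Tri A B M) := ⟨⟨1, 0, 1⟩⟩
instance : Mul (Tri A B M) :=
  ⟨fun x y => ⟨x.a * y.a, op y.a • x.m + x.b • y.m, x.b * y.b⟩⟩

@[simp] lemma zero_a : (0 : Tri A B M).a = 0 := rfl
@[simp] lemma zero_m : (0 : Tri A B M).m = 0 := rfl
@[simp] lemma zero_b : (0 : Tri A B M).b = 0 := rfl
@[simp] lemma add_a (x y : Tri A B M) : (x + y).a = x.a + y.a := rfl
@[simp] lemma add_m (x y : Tri A B M) : (x + y).m = x.m + y.m := rfl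
@[simp] lemma add_b (x y : Tri A B M) : (x + y).b = x.b + y.b := rfl
@[simp] lemma neg_a (x : Tri A B M) : (-x).a = -x.a := rfl
@[simp] lemma neg_m (x : Tri A B M) : (-x).m = -x.m := rfl
@[simp] lemma neg_b (x : Tri A B M) : (-x).b = -x.b := rfl
@[simp] lemma one_a : (1 : Tri A B M).a = 1 := rfl
@[simp] lemma one_m : (1 : Tri A B M).m = 0 := rfl
@[simp] lemma one_b : (1 : Tri A B M).b = 1 := rfl
@[simp] lemma mul_a (x y : Tri A B M) : (x * y).a = x.a * y.a := rfl
@[simp] lemma mul_m (x y : Tri A B M) : (x * y).m = op y.a • x.m + x.b • y.m := rfl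
@[simp] lemma mul_b (x y : Tri A B M) : (x * y).b = x.b * y.b := rfl

instance : AddCommGroup (Tri A B M) where
  add_assoc x y z := by ext <;> simp [add_assoc]
  zero_add x := by ext <;> simp
  add_zero x := by ext <;> simp
  add_comm x y := by ext <;> simp [add_comm]
  neg_add_cancel x := by ext <;> simp
  nsmul := nsmulRec
  zsmul := zsmulRec

instance : Ring (Tri A B M) :=
  { (inferInstance : AddCommGroup (Tri A B M)),
    (inferInstance : Mul (Tri A B M)),
    (inferInstance : One (Tri A B M)) with
    left_distrib := fun x y z => by
      ext <;> simp [mul_add, smul_add, add_smul] <;> abel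
    right_distrib := fun x y z => by
      ext <;> simp [add_mul, smul_add, add_smul] <;> abel
    zero_mul := fun x => by ext <;> simp
    mul_zero := fun x => by ext <;> simp
    mul_assoc := fun x y z => by
      refine Tri.ext (mul_assoc _ _ _) ?_ (mul_assoc _ _ _)
      simp only [mul_m, mul_b, mul_a, smul_add, op_mul, mul_smul]
      rw [smul_comm x.b (op z.a) y.m]
      abel
    one_mul := fun x => by ext <;> simp
    mul_one := fun x => by ext <;> simp }

end Tri

/-! ### Corner rings -/

/-- The corner ring `eΛe` of a ring `Λ` at an idempotent `e`, with unit `e`. -/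
def Corner {Λ : Type u} [Ring Λ] (e : Λ) (_ : IsIdempotentElem e) : Type u :=
  {x : Λ // e * x = x ∧ x * e = x}

namespace Corner
variable {Λ : Type u} [Ring Λ] {e : Λ} {he : IsIdempotentElem e}

instance : Zero (Corner e he) := ⟨⟨0, by simp, by simp⟩⟩
instance : Add (Corner e he) :=
  ⟨fun x y => ⟨x.1 + y.1, by rw [mul_add, x.2.1, y.2.1], by rw [add_mul, x.2.2, y.2.2]⟩⟩
instance : Neg (Corner e he) :=
  ⟨fun x => ⟨-x.1, by rw [mul_neg, x.2.1], by rw [neg_mul, x.2.2]⟩⟩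
instance : Mul (Corner e he) :=
  ⟨fun x y => ⟨x.1 * y.1, by rw [← mul_assoc, x.2.1], by rw [mul_assoc, y.2.2]⟩⟩
instance : One (Corner e he) := ⟨⟨e, he, he⟩⟩

instance : Ring (Corner e he) where
  add_assoc x y z := Subtype.ext (add_assoc _ _ _)
  zero_add x := Subtype.ext (zero_add _)
  add_zero x := Subtype.ext (add_zero _)
  add_comm x y := Subtype.ext (add_comm _ _)
  neg_add_cancel x := Subtype.ext (neg_add_cancel _)
  nsmul := nsmulRec
  zsmul := zsmulRec
  left_distrib x y z := Subtype.ext (mul_add _ _ _)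
  right_distrib x y z := Subtype.ext (add_mul _ _ _)
  zero_mul x := Subtype.ext (zero_mul _)
  mul_zero x := Subtype.ext (mul_zero _)
  mul_assoc x y z := Subtype.ext (mul_assoc _ _ _)
  one_mul x := Subtype.ext x.2.1
  mul_one x := Subtype.ext x.2.2

end Corner

/-! ### Projective dimension and finitistic dimensions -/

/-- `pdLE R n M` : `M` has projective dimension at most `n` as a left `R`-module. -/
def pdLE (R : Type u) [Ring R] : (n : ℕ) → (M : Type u) → [AddCommGroup M] → [Module R M] → Prop
  | 0, M, _, _ => Module.Projective R M
  | n+1, M, _, _ => ∃ (P : Type u) (_ : AddCommGroup P) (_ : Module R P),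
      Module.Projective R P ∧
      ∃ f : P →ₗ[R] M, Function.Surjective f ∧ pdLE R n (LinearMap.ker f)

/-- The projective dimension of a left `R`-module, as an element of `ℕ∞`
(with value `⊤` when no finite projective resolution exists). -/
noncomputable def projDim (R : Type u) [Ring R] (M : Type u) [AddCommGroup M] [Module R M] : ℕ∞ :=
  sInf {d : ℕ∞ | ∃ n : ℕ, d = n ∧ pdLE R n M}

/-- `fgpdLE R n M` : `M` admits a resolution of length at most `n` by finitely
generated projective left `R`-modules. -/
def fgpdLE (R : Type u) [Ring R] :
    (n : ℕ) → (M : Type u) → [AddCommGroup M] → [Module R M] → Prop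
  | 0, M, _, _ => Module.Projective R M ∧ Module.Finite R M
  | n+1, M, _, _ => ∃ (P : Type u) (_ : AddCommGroup P) (_ : Module R P),
      (Module.Projective R P ∧ Module.Finite R P) ∧
      ∃ f : P →ₗ[R] M, Function.Surjective f ∧ fgpdLE R n (LinearMap.ker f)

/-- The small finitistic dimension of `R`, computed with *left* `R`-modules: the
supremum of the projective dimensions of the left modules admitting a finite
resolution by finitely generated projectives. -/
noncomputable def smallFinDimLeft (R : Type u) [Ring R] : ℕ∞ :=
  sSup {d : ℕ∞ | ∃ (M : Type u) (_ : AddCommGroup M) (_ : Module R M),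
    (∃ n : ℕ, fgpdLE R n M) ∧ projDim R M = d}

/-- The big finitistic dimension of `R`, computed with *left* `R`-modules: the
supremum of all finite projective dimensions of left `R`-modules. -/
noncomputable def bigFinDimLeft (R : Type u) [Ring R] : ℕ∞ :=
  sSup {d : ℕ∞ | d ≠ ⊤ ∧ ∃ (M : Type u) (_ : AddCommGroup M) (_ : Module R M),
    projDim R M = d}

/-- `fin.dim R` : the small finitistic dimension of `R`, computed with right
`R`-modules (= left `Rᵐᵒᵖ`-modules). -/
noncomputable def finDim (R : Type u) [Ring R] : ℕ∞ := smallFinDimLeft Rᵐᵒᵖ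

/-- `Fin.dim R` : the big finitistic dimension of `R`, computed with right
`R`-modules (= left `Rᵐᵒᵖ`-modules). -/
noncomputable def bigFinDim (R : Type u) [Ring R] : ℕ∞ := bigFinDimLeft Rᵐᵒᵖ

/-! ### Radical, socle, perfect and semilocal rings, Morita equivalence -/

/-- The radical of a module: the intersection of all maximal submodules. -/
def moduleRad (R M : Type u) [Ring R] [AddCommGroup M] [Module R M] : Submodule R M :=
  sInf {N : Submodule R M | IsCoatom N}

/-- The socle of a module: the sum of all simple submodules. -/
def moduleSoc (R M : Type u) [Ring R] [AddCommGroup M] [Module R M] : Submodule R M :=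
  sSup {N : Submodule R M | IsSimpleModule R ↥N}

/-- A ring is right perfect if every right module has a projective cover,
i.e. a superfluous epimorphism from a projective module. -/
def IsRightPerfect (R : Type u) [Ring R] : Prop :=
  ∀ (M : Type u) (_ : AddCommGroup M) (_ : Module Rᵐᵒᵖ M),
    ∃ (P : Type u) (_ : AddCommGroup P) (_ : Module Rᵐᵒᵖ P) (f : P →ₗ[Rᵐᵒᵖ] M),
      Module.Projective Rᵐᵒᵖ P ∧ Function.Surjective f ∧
      ∀ N : Submodule Rᵐᵒᵖ P, N ⊔ LinearMap.ker f = ⊤ → N = ⊤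

/-- A ring is left perfect if every left module has a projective cover. -/
def IsLeftPerfect (R : Type u) [Ring R] : Prop :=
  ∀ (M : Type u) (_ : AddCommGroup M) (_ : Module R M),
    ∃ (P : Type u) (_ : AddCommGroup P) (_ : Module R P) (f : P →ₗ[R] M),
      Module.Projective R P ∧ Function.Surjective f ∧
      ∀ N : Submodule R P, N ⊔ LinearMap.ker f = ⊤ → N = ⊤

/-- A ring is semilocal if its quotient by the Jacobson radical is semisimple;
equivalently, there is a surjective ring homomorphism onto a semisimple ring
whose kernel is the Jacobson radical. -/
def IsSemilocal (A : Type u) [Ring A] : Prop :=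
  ∃ (T : Type u) (_ : Ring T) (f : A →+* T), Function.Surjective f ∧
    IsSemisimpleRing T ∧ RingHom.ker f = (⊥ : Ideal A).jacobson

/-- Morita equivalence, via the categories of right modules. -/
def MoritaEquiv (R S : Type u) [Ring R] [Ring S] : Prop :=
  Nonempty (ModuleCat.{u} Rᵐᵒᵖ ≌ ModuleCat.{u} Sᵐᵒᵖ)

/-- Powers of an additive subgroup of a ring (e.g. of the Jacobson radical of a
not necessarily commutative ring), defined via products. -/
def addSubgroupPow {R : Type u} [Ring R] (I : AddSubgroup R) : ℕ → AddSubgroup R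
  | 0 => ⊤
  | 1 => I
  | n+2 => AddSubgroup.closure {x : R | ∃ p ∈ I, ∃ q ∈ addSubgroupPow I (n+1), x = p * q}

/-- Left multiplication by a fixed element, as an endomorphism of the right
regular module. -/
def leftMulHom (R : Type u) [Ring R] (z : R) : R →ₗ[Rᵐᵒᵖ] R where
  toFun x := z * x
  map_add' := mul_add z
  map_smul' r x := (mul_assoc z x r.unop).symm

/-! ### The asymmetric cover -/

/-- The endomorphism ring of the right `A`-module `S i`. -/
abbrev EndS (A : Type u) [Ring A] {ι : Type u} (S : ι → Type u)
    [∀ i, AddCommGroup (S i)] [∀ i, Module Aᵐᵒᵖ (S i)] (i : ι) : Type u :=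
  Module.End Aᵐᵒᵖ (S i)

/-- `Ā = ∏_{S ∈ Σ(A)} T(End_A(S))`, the product over the simple right `A`-modules
of the trivial extensions of their endomorphism rings. -/
abbrev Abar (A : Type u) [Ring A] {ι : Type u} (S : ι → Type u)
    [∀ i, AddCommGroup (S i)] [∀ i, Module Aᵐᵒᵖ (S i)] : Type u :=
  ∀ i, TrivSqZeroExt (EndS A S i) (EndS A S i)

/-- `S̄ = ⊕_{S ∈ Σ(A)} S`, the direct sum of the simple right `A`-modules. -/
abbrev Sbar (A : Type u) [Ring A] {ι : Type u} (S : ι → Type u)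
    [∀ i, AddCommGroup (S i)] [∀ i, Module Aᵐᵒᵖ (S i)] : Type u :=
  ⨁ i, S i

/-- The canonical projection `T(B) → B` from a trivial extension, as a ring
homomorphism. -/
def tszeFst (B : Type u) [Ring B] : TrivSqZeroExt B B →+* B where
  toFun x := x.fst
  map_one' := rfl
  map_mul' _ _ := rfl
  map_zero' := rfl
  map_add' _ _ := rfl

section
variable (A : Type u) [Ring A] {ι : Type u} (S : ι → Type u)
  [∀ i, AddCommGroup (S i)] [∀ i, Module Aᵐᵒᵖ (S i)]

/-- The left `Ā`-action on each simple module `S i`, via `Ā → T(End_A(S i)) → End_A(S i)`. -/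
instance instModuleAbarS (i : ι) : Module (Abar A S) (S i) where
  smul r x := (r i).fst x
  one_smul x := rfl
  mul_smul r s x := rfl
  smul_zero r := map_zero _
  smul_add r x y := map_add _ x y
  add_smul r s x := LinearMap.add_apply _ _ _
  zero_smul x := rfl

lemma abar_smul_def (r : Abar A S) (i : ι) (x : S i) : r • x = (r i).fst x := rfl

instance instSMulCommAbarS (i : ι) : SMulCommClass (Abar A S) Aᵐᵒᵖ (S i) where
  smul_comm r a x := map_smul ((r i).fst) a x

instance instSMulCommAbarSbar : SMulCommClass (Abar A S) Aᵐᵒᵖ (Sbar A S) where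
  smul_comm r a x := by
    refine DFinsupp.ext fun i => ?_
    exact smul_comm r a (x i)

end

/-- The asymmetric cover `Ã = [[A,0],[S̄,Ā]]` of the ring `A`, relative to a
family `S : ι → Type u` of representatives of the simple right `A`-modules. -/
abbrev AsymCover (A : Type u) [Ring A] {ι : Type u} (S : ι → Type u)
    [∀ i, AddCommGroup (S i)] [∀ i, Module Aᵐᵒᵖ (S i)] : Type u :=
  Tri A (Abar A S) (Sbar A S)

/-- `S : ι → Type u` is a complete irredundant family of representatives of the
isomorphism classes of simple right `A`-modules. -/
def IsSimpleFamily (A : Type u) [Ring A] {ι : Type u} (S : ι → Type u)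
    [∀ i, AddCommGroup (S i)] [∀ i, Module Aᵐᵒᵖ (S i)] : Prop :=
  (∀ i, IsSimpleModule Aᵐᵒᵖ (S i)) ∧
  (∀ (T : Type u) (_ : AddCommGroup T) (_ : Module Aᵐᵒᵖ T),
    IsSimpleModule Aᵐᵒᵖ T → ∃ i, Nonempty (T ≃ₗ[Aᵐᵒᵖ] S i)) ∧
  (∀ i j, Nonempty (S i ≃ₗ[Aᵐᵒᵖ] S j) → i = j)

/-- Every finite family in `R` either generates the unit right ideal, or is annihilated on the
left by a common nonzero element: finitely generated proper right ideals have nonzero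
left annihilators. -/
def FGProperRightIdealsAnnihilated (R : Type u) [Ring R] : Prop :=
  ∀ (m : ℕ) (x : Fin m → R),
    (∃ y : Fin m → R, ∑ k, x k * y k = 1) ∨ ∃ c : R, c ≠ 0 ∧ ∀ k, c * x k = 0

lemma FGProperRightIdealsAnnihilated.op_op {R : Type u} [Ring R]
    (h : FGProperRightIdealsAnnihilated R) : FGProperRightIdealsAnnihilated Rᵐᵒᵖᵐᵒᵖ := by
  intro m x
  rcases h m (fun k => (x k).unop.unop) with ⟨y, hy⟩ | ⟨c, hc, hcx⟩
  · refine .inl ⟨fun k => op (op (y k)), unop_injective (unop_injective ?_)⟩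
    simpa using hy
  · refine .inr ⟨op (op c), by simpa using hc, fun k => unop_injective (unop_injective ?_)⟩
    simpa using hcx k

/-- Independent families in a finite free module have dual families of functionals. -/
lemma FGProperRightIdealsAnnihilated.exists_dual_family {R : Type u} [Ring R]
    (h : FGProperRightIdealsAnnihilated R) {m : ℕ} :
    ∀ (n : ℕ) (p : Fin n → Fin m → R),
      (∀ c : Fin n → R, ∑ j, c j • p j = 0 → c = 0) →
      ∃ φ : Fin n → ((Fin m → R) →ₗ[R] R), ∀ j k, φ k (p j) = if j = k then 1 else 0
  | 0, p, hp => ⟨fun k => k.elim0, fun j => j.elim0⟩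
  | n + 1, p, hp => by
    obtain ⟨g, hg⟩ : ∃ g : (Fin m → R) →ₗ[R] R, g (p 0) = 1 := by
      rcases h m (p 0) with ⟨y, hy⟩ | ⟨c, hc, hcp⟩
      · exact ⟨Fintype.linearCombination R y, by simpa [Fintype.linearCombination_apply] using hy⟩
      · refine absurd ?_ hc
        have h0 := hp (Fin.cons c 0) (by
          rw [Fin.sum_univ_succ]
          ext k
          simp [hcp k])
        simpa using congrFun h0 0
    let π : (Fin m → R) →ₗ[R] (Fin m → R) := LinearMap.id - g.smulRight (p 0)
    have hπ0 : π (p 0) = 0 := by simp [π, hg]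
    obtain ⟨φ, hφ⟩ := exists_dual_family h n (fun j => π (p j.succ)) (by
      intro c hc
      have h0 := hp (Fin.cons (-∑ j, c j * g (p j.succ)) c) (by
        rw [Fin.sum_univ_succ, ← hc]
        simp only [Fin.cons_zero, Fin.cons_succ, π, LinearMap.sub_apply, LinearMap.id_apply,
          LinearMap.smulRight_apply, smul_sub, Finset.sum_sub_distrib, smul_smul, neg_smul,
          Finset.sum_smul]
        abel)
      ext j
      simpa using congrFun h0 j.succ)
    let ψ : Fin n → ((Fin m → R) →ₗ[R] R) := fun k => φ k ∘ₗ π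
    have hψ0 : ∀ k, ψ k (p 0) = 0 := fun k => by simp [ψ, hπ0]
    have hψ : ∀ j k, ψ k (p j.succ) = if j = k then 1 else 0 := fun j k => hφ j k
    refine ⟨Fin.cons (g - ∑ k, (ψ k).smulRight (g (p k.succ))) ψ, fun j k => ?_⟩
    refine Fin.cases ?_ (fun j => ?_) j <;> refine Fin.cases ?_ (fun k => ?_) k
    · simp [hψ0, hg]
    · simp [hψ0, (Fin.succ_ne_zero k).symm]
    · simp [hψ, Fin.succ_ne_zero j]
    · simp [hψ]

/-- Injections between finitely generated projective modules split. -/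
lemma FGProperRightIdealsAnnihilated.exists_leftInverse {R : Type u} [Ring R]
    (h : FGProperRightIdealsAnnihilated R) {K P : Type u} [AddCommGroup K] [Module R K]
    [AddCommGroup P] [Module R P] [Module.Projective R K] [Module.Finite R K]
    [Module.Projective R P] [Module.Finite R P] (i : K →ₗ[R] P) (hi : Injective i) :
    ∃ ρ : P →ₗ[R] K, ρ ∘ₗ i = LinearMap.id := by
  obtain ⟨n, r, s, -, -, hrs⟩ := Module.Finite.exists_comp_eq_id_of_projective R K
  obtain ⟨m, r', s', -, -, hrs'⟩ :=
    Module.Finite.exists_comp_eq_id_of_projective R (P × (Fin n → R))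
  have hrs1 : ∀ k, r (s k) = k := fun k => LinearMap.congr_fun hrs k
  have hrs2 : ∀ k, r' (s' k) = k := fun k => LinearMap.congr_fun hrs' k
  let j : (Fin n → R) →ₗ[R] P × (Fin n → R) := (i ∘ₗ r).prod (LinearMap.id - s ∘ₗ r)
  have hj : ∀ v, j v = 0 → v = 0 := by
    intro v hv
    have h1 : i (r v) = 0 := congrArg Prod.fst hv
    have h2 : v - s (r v) = 0 := congrArg Prod.snd hv
    rw [hi (h1.trans (map_zero i).symm)] at h2
    simpa using h2
  obtain ⟨φ, hφ⟩ := h.exists_dual_family n (fun l => s' (j (Pi.single l 1))) (by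
    intro c hc
    apply hj
    have h1 : s' (j c) = 0 := by
      rw [← hc]
      conv_lhs => rw [pi_eq_sum_univ' c]
      simp only [map_sum, map_smul]
    rw [← hrs2 (j c), h1, map_zero])
  let ρ : P × (Fin n → R) →ₗ[R] (Fin n → R) := LinearMap.pi φ ∘ₗ s'
  have hρ : ρ ∘ₗ j = LinearMap.id := by
    refine LinearMap.pi_ext' fun l => LinearMap.ext_ring (funext fun k => ?_)
    simpa [ρ, Pi.single_apply, eq_comm] using hφ l k
  refine ⟨r ∘ₗ ρ ∘ₗ LinearMap.inl R P (Fin n → R), LinearMap.ext fun k => ?_⟩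
  have hk : (i k, (0 : Fin n → R)) = j (s k) := by simp [j, hrs1]
  have := LinearMap.congr_fun hρ (s k)
  simp only [LinearMap.comp_apply, LinearMap.inl_apply, LinearMap.id_apply] at this ⊢
  rw [hk, this, hrs1]

lemma FGProperRightIdealsAnnihilated.projective_of_fgpdLE {R : Type u} [Ring R]
    (h : FGProperRightIdealsAnnihilated R) :
    ∀ (n : ℕ) (M : Type u) [AddCommGroup M] [Module R M], fgpdLE R n M →
      Module.Projective R M ∧ Module.Finite R M
  | 0, M, _, _, hM => hM
  | n + 1, M, _, _, ⟨P, _, _, ⟨_, _⟩, f, hf, hK⟩ => by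
    obtain ⟨_, _⟩ := projective_of_fgpdLE h n _ hK
    obtain ⟨ρ, hρ⟩ := h.exists_leftInverse (LinearMap.ker f).subtype Subtype.val_injective
    refine ⟨?_, Module.Finite.of_surjective f hf⟩
    let t : M →ₗ[R] P :=
      (LinearMap.ker f).liftQ (LinearMap.id - (LinearMap.ker f).subtype ∘ₗ ρ) (by
        intro x hx
        have := LinearMap.congr_fun hρ ⟨x, hx⟩
        simp only [LinearMap.comp_apply, Submodule.subtype_apply, LinearMap.id_apply] at this
        simp [this]) ∘ₗ (f.quotKerEquivOfSurjective hf).symm.toLinearMap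
    refine Module.Projective.of_split t f (LinearMap.ext fun y => ?_)
    obtain ⟨x, rfl⟩ := hf y
    have hx : (f.quotKerEquivOfSurjective hf).symm (f x) = (LinearMap.ker f).mkQ x := by
      rw [LinearEquiv.symm_apply_eq]; rfl
    simp [t, hx]

lemma FGProperRightIdealsAnnihilated.smallFinDimLeft_eq_zero {R : Type u} [Ring R]
    (h : FGProperRightIdealsAnnihilated R) : smallFinDimLeft R = 0 := by
  refine le_antisymm (sSup_le ?_) bot_le
  rintro d ⟨M, _, _, ⟨n, hn⟩, rfl⟩
  exact sInf_le ⟨0, rfl, (h.projective_of_fgpdLE n M hn).1⟩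

/-- Any element of a trivial extension with invertible first component is right invertible. -/
lemma TrivSqZeroExt.exists_mul_eq_one {B : Type u} [Ring B] (x : TrivSqZeroExt B B)
    (hx : IsUnit x.fst) : ∃ y, x * y = 1 := by
  obtain ⟨u, hu⟩ := hx
  refine ⟨TrivSqZeroExt.inl (↑u⁻¹ : B) - TrivSqZeroExt.inr (↑u⁻¹ * x.snd * ↑u⁻¹ : B), ?_⟩
  ext
  · simp [← hu]
  · simp [← hu, mul_assoc]

section
variable {A : Type u} [Ring A] {ι : Type u} {S : ι → Type u}
  [∀ i, AddCommGroup (S i)] [∀ i, Module Aᵐᵒᵖ (S i)]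

/-- Each proper right ideal of `A` annihilates a nonzero element of some simple right module. -/
lemma exists_simple_annihilated (J : Submodule Aᵐᵒᵖ A) (hJ : J ≠ ⊤) :
    ∃ N : Submodule Aᵐᵒᵖ A, IsSimpleModule Aᵐᵒᵖ (A ⧸ N) ∧
      N.mkQ 1 ≠ 0 ∧ ∀ a ∈ J, op a • N.mkQ 1 = 0 := by
  have : Module.Finite Aᵐᵒᵖ A := ⟨⟨{1}, by
    rw [eq_top_iff]
    intro a _
    rw [Finset.coe_singleton]
    exact Submodule.mem_span_singleton.2 ⟨op a, one_mul a⟩⟩⟩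
  obtain ⟨N, hN, hJN⟩ := (eq_top_or_exists_le_coatom J).resolve_left hJ
  refine ⟨N, isSimpleModule_iff_isCoatom.2 hN, fun h0 => hN.1 ?_, fun a ha => ?_⟩
  · rw [Submodule.mkQ_apply, Submodule.Quotient.mk_eq_zero] at h0
    rw [eq_top_iff]
    intro a _
    have h1 := N.smul_mem (op a) h0
    rwa [op_smul_eq_mul, one_mul] at h1
  · rw [← map_smul, op_smul_eq_mul, one_mul, Submodule.mkQ_apply, Submodule.Quotient.mk_eq_zero]
    exact hJN ha

lemma IsSimpleFamily.exists_annihilated (hfam : IsSimpleFamily A S)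
    (J : Submodule Aᵐᵒᵖ A) (hJ : J ≠ ⊤) :
    ∃ (i : ι) (s : S i), s ≠ 0 ∧ ∀ a ∈ J, op a • s = 0 := by
  obtain ⟨N, hN, h1, hJN⟩ := exists_simple_annihilated J hJ
  obtain ⟨i, ⟨e⟩⟩ := hfam.2.1 (A ⧸ N) inferInstance inferInstance hN
  refine ⟨i, e (N.mkQ 1), fun h0 => h1 (e.injective (h0.trans (map_zero e).symm)), fun a ha => ?_⟩
  rw [← map_smul, hJN a ha, map_zero]

/-- The elements of `Abar` concentrated in the square-zero part annihilate `Sbar`. -/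
lemma Abar.smul_eq_zero_of_fst_eq_zero (r : Abar A S) (hr : ∀ i, (r i).fst = 0) (x : Sbar A S) :
    r • x = 0 := by
  refine DFinsupp.ext fun i => ?_
  change (r i).fst (x i) = 0
  rw [hr i, LinearMap.zero_apply]

/-- The element of the square-zero part of `Abar` with value `1` at the single index `i`. -/
def Abar.inrSingle [DecidableEq ι] (i : ι) : Abar A S :=
  Pi.single i (TrivSqZeroExt.inr 1)

lemma Abar.inrSingle_fst [DecidableEq ι] (i j : ι) :
    ((Abar.inrSingle i : Abar A S) j).fst = 0 := by
  by_cases hj : j = i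
  · subst hj
    simp [Abar.inrSingle]
  · simp [Abar.inrSingle, hj]

lemma Abar.inrSingle_mul [DecidableEq ι] (i : ι) (b : Abar A S) (hb : (b i).fst = 0) :
    Abar.inrSingle i * b = 0 := by
  funext j
  by_cases hj : j = i
  · subst hj
    ext1 <;> simp [Abar.inrSingle, hb]
  · simp [Abar.inrSingle, hj]

lemma AsymCover.exists_annihilator_of_fst_eq_zero (i : ι) [Nontrivial (S i)] {m : ℕ}
    (x : Fin m → AsymCover A S) (hx : ∀ k, ((x k).b i).fst = 0) :
    ∃ c : AsymCover A S, c ≠ 0 ∧ ∀ k, c * x k = 0 := by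
  classical
  refine ⟨⟨0, 0, Abar.inrSingle i⟩, fun h0 => ?_, fun k => Tri.ext (zero_mul _) ?_ ?_⟩
  · have h1 : (Abar.inrSingle i : Abar A S) i = 0 := congrFun (congrArg Tri.b h0) i
    have h2 := congrArg TrivSqZeroExt.snd h1
    rw [Abar.inrSingle, Pi.single_eq_same, TrivSqZeroExt.snd_inr, TrivSqZeroExt.snd_zero] at h2
    exact one_ne_zero h2
  · rw [Tri.mul_m, Abar.smul_eq_zero_of_fst_eq_zero _ (Abar.inrSingle_fst i), smul_zero, add_zero]
    rfl
  · exact Abar.inrSingle_mul i _ (hx k)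

lemma AsymCover.exists_annihilator_of_smul_eq_zero (i : ι) (s : S i) (hs : s ≠ 0) {m : ℕ}
    (x : Fin m → AsymCover A S) (hx : ∀ k, op (x k).a • s = 0) :
    ∃ c : AsymCover A S, c ≠ 0 ∧ ∀ k, c * x k = 0 := by
  classical
  refine ⟨⟨0, DFinsupp.single i s, 0⟩, fun h0 => hs ?_,
    fun k => Tri.ext (zero_mul _) ?_ (zero_mul _)⟩
  · have h1 : (DFinsupp.single i s : Sbar A S) = 0 := congrArg Tri.m h0
    exact DFinsupp.single_eq_zero.1 h1
  · have h1 : op (x k).a • (DFinsupp.single i s : Sbar A S) = 0 := by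
      refine (DFinsupp.single_smul (i := i) (op (x k).a) s).symm.trans ?_
      rw [hx k, DFinsupp.single_zero]
    rw [Tri.mul_m, h1, zero_smul, add_zero]
    rfl

lemma Tri.exists_sum_mul_eq_one {B M : Type u} [Ring B] [AddCommGroup M] [Module B M]
    [Module Aᵐᵒᵖ M] [SMulCommClass B Aᵐᵒᵖ M] {m : ℕ} (x : Fin m → Tri A B M)
    (α : Fin m → A) (hα : ∑ k, (x k).a * α k = 1)
    (γ : Fin m → B) (hγ : ∑ k, (x k).b * γ k = 1) :
    ∃ y : Fin m → Tri A B M, ∑ k, x k * y k = 1 := by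
  let μ : M := ∑ k, op (α k) • (x k).m
  let aHom : Tri A B M →+ A := ⟨⟨Tri.a, rfl⟩, fun _ _ => rfl⟩
  let mHom : Tri A B M →+ M := ⟨⟨Tri.m, rfl⟩, fun _ _ => rfl⟩
  let bHom : Tri A B M →+ B := ⟨⟨Tri.b, rfl⟩, fun _ _ => rfl⟩
  refine ⟨fun k => ⟨α k, -(γ k • μ), γ k⟩, Tri.ext ?_ ?_ ?_⟩
  · exact (map_sum aHom _ _).trans hα
  · refine (map_sum mHom _ _).trans ?_
    change ∑ k, (op (α k) • (x k).m + (x k).b • -(γ k • μ)) = 0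
    simp only [smul_neg, smul_smul, Finset.sum_add_distrib, Finset.sum_neg_distrib]
    rw [← Finset.sum_smul, hγ, one_smul]
    exact add_neg_cancel μ
  · exact (map_sum bHom _ _).trans hγ

lemma Abar.exists_sum_mul_eq_one (hS : ∀ i, IsSimpleModule Aᵐᵒᵖ (S i)) {m : ℕ}
    (b : Fin m → Abar A S) (hb : ∀ i, ∃ k, (b k i).fst ≠ 0) :
    ∃ γ : Fin m → Abar A S, ∑ k, b k * γ k = 1 := by
  choose κ hκ using hb
  have hinv : ∀ i, ∃ y, b (κ i) i * y = 1 := fun i =>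
    TrivSqZeroExt.exists_mul_eq_one _
      ((Module.End.isUnit_iff _).2 (LinearMap.bijective_of_ne_zero (hκ i)))
  choose β hβ using hinv
  refine ⟨fun k i => if k = κ i then β i else 0, funext fun i => ?_⟩
  rw [Finset.sum_apply, Finset.sum_eq_single (κ i)]
  · simp [hβ]
  · intro k _ hk
    simp [hk]
  · simp

lemma fgProperRightIdealsAnnihilated_asymCover (hfam : IsSimpleFamily A S) :
    FGProperRightIdealsAnnihilated (AsymCover A S) := by
  intro m x
  have hS := hfam.1
  by_cases hB : ∃ i, ∀ k, ((x k).b i).fst = 0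
  · obtain ⟨i, hi⟩ := hB
    have : Nontrivial (S i) := IsSimpleModule.nontrivial Aᵐᵒᵖ (S i)
    exact .inr (AsymCover.exists_annihilator_of_fst_eq_zero i x hi)
  push Not at hB
  by_cases hA : Submodule.span Aᵐᵒᵖ (Set.range fun k => (x k).a) = ⊤
  · have h1 : (1 : A) ∈ Submodule.span Aᵐᵒᵖ (Set.range fun k => (x k).a) := hA ▸ trivial
    obtain ⟨α, hα⟩ := (Submodule.mem_span_range_iff_exists_fun _).1 h1
    obtain ⟨γ, hγ⟩ := Abar.exists_sum_mul_eq_one hS (fun k => (x k).b) hB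
    exact .inl (Tri.exists_sum_mul_eq_one x (fun k => (α k).unop) hα γ hγ)
  · obtain ⟨i, s, hs, hsJ⟩ := hfam.exists_annihilated _ hA
    exact .inr (AsymCover.exists_annihilator_of_smul_eq_zero i s hs x
      fun k => hsJ _ (Submodule.subset_span ⟨k, rfl⟩))

end

/-- For any ring `A` and its asymmetric cover
`Ã = [[A,0],[S̄,Ā]]`, the small finitistic dimension of the opposite ring
vanishes: `fin.dim Ã^op = 0`. -/
theorem finDim_op_asymCover_eq_zero
    (A : Type u) [Ring A] {ι : Type u} (S : ι → Type u)
    [∀ i, AddCommGroup (S i)] [∀ i, Module Aᵐᵒᵖ (S i)]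
    (hfam : IsSimpleFamily A S) :
    finDim (AsymCover A S)ᵐᵒᵖ = 0 := by
  exact (fgProperRightIdealsAnnihilated_asymCover hfam).op_op.smallFinDimLeft_eq_zero
end

section
/- Let A be a right perfect ring with fin.dim A = 0. Then every monomorphism φ : M → N between projective right A-modules splits; in particular the cokernel of any such monomorphism, being a filtered colimit of projective modules over a right perfect ring, is projective. -/
set_option linter.unusedSectionVars false
set_option synthInstance.maxHeartbeats 1000000
set_option maxHeartbeats 1600000
set_option linter.unusedVariables false
set_option linter.unnecessarySeqFocus false

universe u
open MulOpposite Function DirectSum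

/-- Over a ring with vanishing small finitistic dimension, every module with a finite resolution
by finitely generated projectives is projective. -/
theorem projective_of_smallFinDimLeft_eq_zero {R : Type u} [Ring R]
    (h : smallFinDimLeft R = 0) {M : Type u} [AddCommGroup M] [Module R M] {n : ℕ}
    (hM : fgpdLE R n M) : Module.Projective R M := by
  have hdim : projDim R M = 0 :=
    le_antisymm (h ▸ le_sSup ⟨M, inferInstance, inferInstance, ⟨n, hM⟩, rfl⟩) bot_le
  have hne : {d : ℕ∞ | ∃ n : ℕ, d = n ∧ pdLE R n M}.Nonempty := by
    by_contra hempty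
    rw [projDim, Set.not_nonempty_iff_eq_empty.mp hempty, sInf_empty] at hdim
    exact ENat.top_ne_zero hdim
  obtain ⟨k, hk, hpd⟩ := csInf_mem hne
  obtain rfl : k = 0 := by
    rw [← Nat.cast_eq_zero (R := ℕ∞), ← hk]
    exact hdim
  exact hpd

/-- An injective linear map with projective cokernel has a retraction. -/
theorem exists_retraction_of_projective_quotient_range {R M N : Type*} [Ring R]
    [AddCommGroup M] [Module R M] [AddCommGroup N] [Module R N] {φ : M →ₗ[R] N}
    (hφ : Injective φ) [Module.Projective R (N ⧸ LinearMap.range φ)] :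
    ∃ g : N →ₗ[R] M, g ∘ₗ φ = LinearMap.id := by
  obtain ⟨s, hs⟩ := Module.projective_lifting_property (LinearMap.range φ).mkQ LinearMap.id
    (LinearMap.range φ).mkQ_surjective
  have hmem (y : N) : ((LinearMap.id : N →ₗ[R] N) - s ∘ₗ (LinearMap.range φ).mkQ) y ∈ LinearMap.range φ := by
    rw [← Submodule.Quotient.mk_eq_zero, ← Submodule.mkQ_apply]
    have := LinearMap.congr_fun hs ((LinearMap.range φ).mkQ y)
    simp only [LinearMap.comp_apply, LinearMap.id_apply] at this
    rw [LinearMap.sub_apply, map_sub, LinearMap.comp_apply, this, LinearMap.id_apply, sub_self]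
  refine ⟨(LinearEquiv.ofInjective φ hφ).symm.toLinearMap ∘ₗ LinearMap.codRestrict _ _ hmem,
    LinearMap.ext fun x => ?_⟩
  simp only [LinearMap.comp_apply, LinearEquiv.coe_coe, LinearMap.id_apply]
  rw [LinearEquiv.symm_apply_eq]
  ext
  have hx : (LinearMap.range φ).mkQ (φ x) = 0 := by simp
  simp [hx]

/-- Over a ring with vanishing small finitistic dimension, an injective linear map between
finitely generated projective modules has a retraction. -/
theorem exists_retraction_of_finite_projective {R : Type u} [Ring R]
    (h : smallFinDimLeft R = 0) {E F : Type u} [AddCommGroup E] [Module R E]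
    [AddCommGroup F] [Module R F] [Module.Projective R E] [Module.Finite R E]
    [Module.Projective R F] [Module.Finite R F] {ψ : E →ₗ[R] F} (hψ : Injective ψ) :
    ∃ r : F →ₗ[R] E, r ∘ₗ ψ = LinearMap.id := by
  let e : E ≃ₗ[R] LinearMap.ker (LinearMap.range ψ).mkQ :=
    (LinearEquiv.ofInjective ψ hψ).trans (LinearEquiv.ofEq _ _ (Submodule.ker_mkQ _).symm)
  have hpd : fgpdLE R 1 (F ⧸ LinearMap.range ψ) :=
    ⟨F, inferInstance, inferInstance, ⟨inferInstance, inferInstance⟩,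
      (LinearMap.range ψ).mkQ, (LinearMap.range ψ).mkQ_surjective,
      Module.Projective.of_equiv e, Module.Finite.equiv e⟩
  have := projective_of_smallFinDimLeft_eq_zero h hpd
  exact exists_retraction_of_projective_quotient_range hψ

/-- Over a ring with vanishing small finitistic dimension, an injective linear map from a
finitely generated projective module to a projective module has a retraction. -/
theorem exists_retraction_of_finite_projective_domain {R : Type u} [Ring R]
    (h : smallFinDimLeft R = 0) {E N : Type u} [AddCommGroup E] [Module R E]
    [AddCommGroup N] [Module R N] [Module.Projective R E] [Module.Finite R E]
    [Module.Projective R N] {ψ : E →ₗ[R] N} (hψ : Injective ψ) :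
    ∃ r : N →ₗ[R] E, r ∘ₗ ψ = LinearMap.id := by
  classical
  obtain ⟨t, ht⟩ := Module.projective_def'.mp ‹Module.Projective R N›
  have htinj : Injective t := fun x y hxy => by
    rw [← LinearMap.id_apply (R := R) x, ← LinearMap.id_apply (R := R) y, ← ht,
      LinearMap.comp_apply, LinearMap.comp_apply, hxy]
  obtain ⟨S, hS⟩ := Module.Finite.fg_top (R := R) (M := E)
  let J : Finset N := S.biUnion fun x => (t (ψ x)).support
  have hsupp (x : E) : t (ψ x) ∈ Finsupp.supported R R (J : Set N) := by
    have hle : Submodule.span R (S : Set E) ≤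
        (Finsupp.supported R R (J : Set N)).comap (t ∘ₗ ψ) := by
      refine Submodule.span_le.mpr fun y hy => ?_
      change ((t (ψ y)).support : Set N) ⊆ J
      exact Finset.coe_subset.mpr (Finset.subset_biUnion_of_mem (fun x => (t (ψ x)).support) hy)
    exact hle (hS ▸ Submodule.mem_top)
  let c : (N →₀ R) →ₗ[R] (J →₀ R) := Finsupp.lcomapDomain Subtype.val Subtype.val_injective
  have hinj : Injective (c ∘ₗ t ∘ₗ ψ) := by
    rw [injective_iff_map_eq_zero]
    intro x hx
    have hzero : t (ψ x) = 0 := by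
      ext j
      by_cases hj : j ∈ J
      · exact DFunLike.congr_fun hx (⟨j, hj⟩ : J)
      · by_contra hne
        exact hj (hsupp x (Finsupp.mem_support_iff.mpr hne))
    exact hψ (htinj (by rw [hzero, map_zero, map_zero]))
  obtain ⟨r, hr⟩ := exists_retraction_of_finite_projective h hinj
  exact ⟨r ∘ₗ c ∘ₗ t, hr⟩

/-- Over a ring with vanishing small finitistic dimension, an injective linear map between
projective modules can be retracted at each single element. -/
theorem exists_linearMap_apply_eq_of_injective {R : Type u} [Ring R]
    (h : smallFinDimLeft R = 0) {M N : Type u} [AddCommGroup M] [Module R M]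
    [AddCommGroup N] [Module R N] [Module.Projective R M] [Module.Projective R N]
    {φ : M →ₗ[R] N} (hφ : Injective φ) (y : M) :
    ∃ r : N →ₗ[R] M, r (φ y) = y := by
  obtain ⟨s, hs⟩ := Module.projective_def'.mp ‹Module.Projective R M›
  set π : (M →₀ R) →ₗ[R] M := Finsupp.linearCombination R id
  have hπs (x : M) : π (s x) = x := LinearMap.congr_fun hs x
  let I : Finset M := (s y).support
  let i : (I →₀ R) →ₗ[R] (M →₀ R) := Finsupp.lmapDomain R R Subtype.val
  have hi : Injective i := Finsupp.mapDomain_injective Subtype.val_injective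
  let ψ : (I →₀ R) →ₗ[R] N × (M →₀ R) :=
    (φ ∘ₗ π ∘ₗ i).prod ((LinearMap.id - s ∘ₗ π) ∘ₗ i)
  have hψ : Injective ψ := by
    rw [injective_iff_map_eq_zero]
    intro z hz
    have h1 : φ (π (i z)) = 0 := congr_arg Prod.fst hz
    have h2 : i z - s (π (i z)) = 0 := congr_arg Prod.snd hz
    rw [(map_eq_zero_iff φ hφ).mp h1, map_zero, sub_zero] at h2
    exact (map_eq_zero_iff i hi).mp h2
  obtain ⟨r, hr⟩ := exists_retraction_of_finite_projective_domain h hψ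
  let z : I →₀ R := (s y).comapDomain Subtype.val Subtype.val_injective.injOn
  have hz : i z = s y :=
    Finsupp.mapDomain_comapDomain _ Subtype.val_injective _ fun m hm => ⟨⟨m, hm⟩, rfl⟩
  have hψz : ψ z = (φ y, 0) := by
    change (φ (π (i z)), i z - s (π (i z))) = (φ y, 0)
    rw [hz, hπs, sub_self]
  refine ⟨π ∘ₗ i ∘ₗ r ∘ₗ LinearMap.inl R N (M →₀ R), ?_⟩
  change π (i (r (φ y, 0))) = y
  rw [← hψz, ← LinearMap.comp_apply r ψ, hr, LinearMap.id_apply, hz, hπs]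

/-- Let `p : P → C` be a projective cover with kernel `K`. An element of `K` fixed by an
endomorphism of `P` with values in `K` vanishes. -/
theorem eq_zero_of_fixed_of_superfluous_ker {R P C : Type*} [Ring R]
    [AddCommGroup P] [Module R P] [AddCommGroup C] [Module R C] [Module.Projective R P]
    {p : P →ₗ[R] C} (hp : ∀ L : Submodule R P, L ⊔ LinearMap.ker p = ⊤ → L = ⊤)
    {u : P →ₗ[R] P} (hu : ∀ y, u y ∈ LinearMap.ker p) {x : P} (hx : u x = x) : x = 0 := by
  set v : P →ₗ[R] P := LinearMap.id - u
  have hv (y : P) : v y = y - u y := rfl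
  have hsurj : Surjective v := by
    rw [← LinearMap.range_eq_top]
    refine hp _ (eq_top_iff.mpr fun y _ => ?_)
    rw [← sub_add_cancel y (u y)]
    exact Submodule.add_mem_sup ⟨y, rfl⟩ (hu y)
  obtain ⟨w, hw⟩ := Module.projective_lifting_property v LinearMap.id hsurj
  have hvw (y : P) : v (w y) = y := LinearMap.congr_fun hw y
  have hrange : LinearMap.range w = ⊤ := by
    refine hp _ (eq_top_iff.mpr fun y _ => ?_)
    have hker : v (y - w (v y)) = 0 := by rw [map_sub, hvw, sub_self]
    rw [hv, sub_eq_zero] at hker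
    rw [← add_sub_cancel (w (v y)) y, hker]
    exact Submodule.add_mem_sup ⟨_, rfl⟩ (hu _)
  obtain ⟨y, rfl⟩ := LinearMap.range_eq_top.mp hrange x
  have hy : v (w y) = 0 := by rw [hv, hx, sub_self]
  rw [← hvw y, hy, map_zero]

/-- If a submodule `L` of a projective module `N` can be retracted at each of its elements, and
`N ⧸ L` has a projective cover, then `N ⧸ L` is projective. -/
theorem projective_quotient_of_projective_cover {R N P : Type*} [Ring R]
    [AddCommGroup N] [Module R N] [Module.Projective R N] {L : Submodule R N}
    (hL : ∀ x ∈ L, ∃ e : N →ₗ[R] N, (∀ y, e y ∈ L) ∧ e x = x)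
    [AddCommGroup P] [Module R P] [Module.Projective R P] {p : P →ₗ[R] N ⧸ L}
    (hsurj : Surjective p) (hp : ∀ K : Submodule R P, K ⊔ LinearMap.ker p = ⊤ → K = ⊤) :
    Module.Projective R (N ⧸ L) := by
  obtain ⟨a, ha⟩ := Module.projective_lifting_property p L.mkQ hsurj
  obtain ⟨b, hb⟩ := Module.projective_lifting_property L.mkQ p L.mkQ_surjective
  have hpa (y : N) : p (a y) = L.mkQ y := LinearMap.congr_fun ha y
  have hqb (y : P) : L.mkQ (b y) = p y := LinearMap.congr_fun hb y
  have hinj : Injective p := by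
    rw [injective_iff_map_eq_zero]
    intro x hx
    have hbx : b x ∈ L := by rw [← Submodule.Quotient.mk_eq_zero, ← L.mkQ_apply, hqb, hx]
    obtain ⟨e, he, hex⟩ := hL _ hbx
    refine eq_zero_of_fixed_of_superfluous_ker hp
      (u := LinearMap.id - a ∘ₗ (LinearMap.id - e) ∘ₗ b) (fun y => ?_) ?_
    · have hq : L.mkQ (e (b y)) = 0 := by simpa using he (b y)
      change p (y - a (b y - e (b y))) = 0
      rw [map_sub, hpa, map_sub, hqb, hq, sub_zero, sub_self]
    · change x - a (b x - e (b x)) = x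
      rw [hex, sub_self, map_zero, sub_zero]
  exact Module.Projective.of_equiv (LinearEquiv.ofBijective p ⟨hinj, hsurj⟩)

/-- Over a right perfect ring `A` with `fin.dim A = 0`,
every monomorphism `φ : M → N` between projective right `A`-modules splits;
in particular its cokernel `N/im φ` is projective. -/
theorem mono_between_projectives_splits_of_rightPerfect
    (A : Type u) [Ring A] (hperf : IsRightPerfect A) (hfd : finDim A = 0)
    (M N : Type u) (_ : AddCommGroup M) (_ : Module Aᵐᵒᵖ M)
    (_ : AddCommGroup N) (_ : Module Aᵐᵒᵖ N)
    (hM : Module.Projective Aᵐᵒᵖ M) (hN : Module.Projective Aᵐᵒᵖ N)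
    (φ : M →ₗ[Aᵐᵒᵖ] N) (hφ : Function.Injective φ) :
    (∃ g : N →ₗ[Aᵐᵒᵖ] M, g.comp φ = LinearMap.id) ∧
    Module.Projective Aᵐᵒᵖ (N ⧸ LinearMap.range φ) := by
  have hproj : Module.Projective Aᵐᵒᵖ (N ⧸ LinearMap.range φ) := by
    obtain ⟨P, _, _, p, _, hsurj, hp⟩ := hperf (N ⧸ LinearMap.range φ) inferInstance inferInstance
    refine projective_quotient_of_projective_cover ?_ hsurj hp
    rintro _ ⟨y, rfl⟩
    obtain ⟨r, hr⟩ := exists_linearMap_apply_eq_of_injective hfd hφ y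
    exact ⟨φ ∘ₗ r, fun z => ⟨r z, rfl⟩, congr_arg φ hr⟩
  exact ⟨exists_retraction_of_projective_quotient_range hφ, hproj⟩
end

section
/- For any ring A and its asymmetric cover Ã = [[A,0],[S̄,Ā]], the big finitistic dimensions satisfy Fin.dim Ã ≥ Fin.dim A. -/
set_option linter.unusedSectionVars false
set_option synthInstance.maxHeartbeats 1000000
set_option maxHeartbeats 1600000
set_option linter.unusedVariables false
set_option linter.unnecessarySeqFocus false

universe u
open MulOpposite Function DirectSum

/-! ### Projective dimension via syzygies -/

lemma pdLE_iff_hasProjectiveDimensionLE (R : Type u) [Ring R] (n : ℕ) (M : Type u)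
    [AddCommGroup M] [Module R M] :
    pdLE R n M ↔ CategoryTheory.HasProjectiveDimensionLE (ModuleCat.of R M) n := by
  induction n generalizing M with
  | zero =>
    rw [← CategoryTheory.projective_iff_hasProjectiveDimensionLE_zero,
      ← IsProjective.iff_projective]
    exact Iff.rfl
  | succ n ih =>
    have key (P : Type u) [AddCommGroup P] [Module R P] [Module.Projective R P]
        (f : P →ₗ[R] M) (hf : Function.Surjective f) :
        CategoryTheory.HasProjectiveDimensionLE (ModuleCat.of R M) (n + 1) ↔
          CategoryTheory.HasProjectiveDimensionLE (ModuleCat.of R (LinearMap.ker f)) n :=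
      (ModuleCat.shortComplex_shortExact (ModuleCat.shortComplexOfCompEqZero
        (LinearMap.ker f).subtype f (LinearMap.comp_ker_subtype f))
        (LinearMap.exact_subtype_ker_map f) Subtype.val_injective
        hf).hasProjectiveDimensionLT_X₃_iff n
        ((IsProjective.iff_projective (R := R) P).mp inferInstance)
    constructor
    · rintro ⟨P, _, _, _, f, hf, h⟩
      exact (key P f hf).mpr ((ih _).mp h)
    · intro h
      have hf := Finsupp.linearCombination_id_surjective R M
      exact ⟨M →₀ R, inferInstance, inferInstance, inferInstance, _, hf,
        (ih _).mpr ((key _ _ hf).mp h)⟩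

/-- Dimension shifting along a short exact sequence with projective middle term. -/
lemma pdLE_succ_iff {R : Type u} [Ring R] (n : ℕ) {K P M : Type u}
    [AddCommGroup K] [AddCommGroup P] [AddCommGroup M] [Module R K] [Module R P] [Module R M]
    [Module.Projective R P] {g : K →ₗ[R] P} {f : P →ₗ[R] M} (hg : Function.Injective g)
    (hgf : Function.Exact g f) (hf : Function.Surjective f) :
    pdLE R (n + 1) M ↔ pdLE R n K := by
  rw [pdLE_iff_hasProjectiveDimensionLE, pdLE_iff_hasProjectiveDimensionLE]
  exact (ModuleCat.shortComplex_shortExact (ModuleCat.shortComplexOfCompEqZero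
    g f hgf.linearMap_comp_eq_zero) hgf hg hf).hasProjectiveDimensionLT_X₃_iff n
    ((IsProjective.iff_projective (R := R) P).mp inferInstance)

/-! ### Projective dimension under restriction of scalars -/

section RestrictScalars
variable {R T : Type u} [Ring R] [Ring T] [Module R T] [IsScalarTower R T T]
  [Module.Projective R T]

lemma projective_restrictScalars_iff (hsurj : Function.Surjective fun r : R => r • (1 : T))
    (M : Type u) [AddCommGroup M] [Module R M] [Module T M] [IsScalarTower R T M] :
    Module.Projective R M ↔ Module.Projective T M := by
  constructor
  · intro _
    refine Module.Projective.of_lifting_property'' fun f hf => ?_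
    obtain ⟨s, hs⟩ := Module.projective_lifting_property (f.restrictScalars R)
      (LinearMap.id : M →ₗ[R] M) hf
    refine ⟨{ toFun := s, map_add' := map_add s, map_smul' := fun t m => ?_ },
      LinearMap.ext fun m => LinearMap.congr_fun hs m⟩
    obtain ⟨r, rfl⟩ := hsurj t
    rw [RingHom.id_apply, smul_assoc, smul_assoc, one_smul, one_smul, map_smul]
  · classical
    intro h
    obtain ⟨s, hs⟩ := Module.projective_def'.mp h
    have : Module.Projective R (M →₀ T) :=
      Module.Projective.of_equiv' (finsuppLequivDFinsupp R).symm
    exact Module.Projective.of_split (s.restrictScalars R)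
      ((Finsupp.linearCombination T (id : M → M)).restrictScalars R)
      (LinearMap.ext fun m => LinearMap.congr_fun hs m)

lemma pdLE_restrictScalars_iff (hsurj : Function.Surjective fun r : R => r • (1 : T)) (n : ℕ)
    (M : Type u) [AddCommGroup M] [Module R M] [Module T M] [IsScalarTower R T M] :
    pdLE R n M ↔ pdLE T n M := by
  induction n generalizing M with
  | zero => exact projective_restrictScalars_iff hsurj M
  | succ n ih =>
    let f := Finsupp.linearCombination T (id : M → M)
    have hf : Function.Surjective f := Finsupp.linearCombination_id_surjective T M
    have hexact : Function.Exact (LinearMap.ker f).subtype f := LinearMap.exact_subtype_ker_map f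
    have hinj : Function.Injective (LinearMap.ker f).subtype := Subtype.val_injective
    let g : LinearMap.ker f →ₗ[R] M →₀ T := (LinearMap.ker f).subtype.restrictScalars R
    have : Module.Projective R (M →₀ T) :=
      (projective_restrictScalars_iff hsurj _).mpr inferInstance
    have hR : pdLE R (n + 1) M ↔ pdLE R n (LinearMap.ker f) :=
      pdLE_succ_iff (g := g) (f := f.restrictScalars R) n hinj hexact hf
    have hT : pdLE T (n + 1) M ↔ pdLE T n (LinearMap.ker f) := pdLE_succ_iff n hinj hexact hf
    rw [hR, hT, ih]

lemma bigFinDimLeft_le_of_projective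
    (hsurj : Function.Surjective fun r : R => r • (1 : T)) (φ : R →+* T)
    (hφ : ∀ (r : R) (t : T), r • t = φ r * t) :
    bigFinDimLeft T ≤ bigFinDimLeft R := by
  refine sSup_le_sSup ?_
  rintro d ⟨hd, M, _, _, rfl⟩
  let _ : Module R M := Module.compHom M φ
  have : IsScalarTower R T M := ⟨fun r t m => by
    rw [hφ, mul_smul]
    rfl⟩
  refine ⟨hd, M, inferInstance, inferInstance, ?_⟩
  simp only [projDim, pdLE_restrictScalars_iff hsurj]

end RestrictScalars

/-! ### The corner `A` of a triangular matrix ring -/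

namespace Tri
variable (A B M : Type u) [Ring A] [Ring B] [AddCommGroup M]
  [Module B M] [Module Aᵐᵒᵖ M] [SMulCommClass B Aᵐᵒᵖ M]

/-- The projection `[[A,0],[M,B]] → A`. -/
def fstHom : Tri A B M →+* A where
  toFun := Tri.a
  map_one' := rfl
  map_mul' _ _ := rfl
  map_zero' := rfl
  map_add' _ _ := rfl

theorem bigFinDim_le : bigFinDim A ≤ bigFinDim (Tri A B M) := by
  let φ : (Tri A B M)ᵐᵒᵖ →+* Aᵐᵒᵖ := (fstHom A B M).op
  let _ : Module (Tri A B M)ᵐᵒᵖ Aᵐᵒᵖ := Module.compHom Aᵐᵒᵖ φ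
  have hφ (r : (Tri A B M)ᵐᵒᵖ) (t : Aᵐᵒᵖ) : r • t = φ r * t := rfl
  have : IsScalarTower (Tri A B M)ᵐᵒᵖ Aᵐᵒᵖ Aᵐᵒᵖ := ⟨fun r t m => by
    simp only [hφ, smul_eq_mul, mul_assoc]⟩
  let i : Aᵐᵒᵖ →ₗ[(Tri A B M)ᵐᵒᵖ] (Tri A B M)ᵐᵒᵖ :=
    { toFun := fun x => op ⟨x.unop, 0, 0⟩
      map_add' := fun x y => unop_injective (by ext <;> simp)
      map_smul' := fun r x => unop_injective (by ext <;> simp [hφ, φ, fstHom]) }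
  let s : (Tri A B M)ᵐᵒᵖ →ₗ[(Tri A B M)ᵐᵒᵖ] Aᵐᵒᵖ :=
    { toFun := φ
      map_add' := map_add φ
      map_smul' := map_mul φ }
  have : Module.Projective (Tri A B M)ᵐᵒᵖ Aᵐᵒᵖ :=
    Module.Projective.of_split i s (LinearMap.ext fun _ => rfl)
  refine bigFinDimLeft_le_of_projective (fun t => ⟨op ⟨t.unop, 0, 0⟩, ?_⟩) φ hφ
  exact mul_one t

end Tri

/-- For any ring `A` and its asymmetric cover
`Ã = [[A,0],[S̄,Ā]]`, the big finitistic dimensions (computed with right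
modules) satisfy `Fin.dim Ã ≥ Fin.dim A`. -/
theorem bigFinDim_le_bigFinDim_asymCover
    (A : Type u) [Ring A] {ι : Type u} (S : ι → Type u)
    [∀ i, AddCommGroup (S i)] [∀ i, Module Aᵐᵒᵖ (S i)]
    (hfam : IsSimpleFamily A S) :
    bigFinDim A ≤ bigFinDim (AsymCover A S) := by
  exact Tri.bigFinDim_le A (Abar A S) (Sbar A S)
end
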